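/- arXiv:2207.09410 — 2 statements merged into one kernel-verified Lean document; each statement's English description precedes it below -/
import Mathlib

section
/- Let c = 2π/√3 and C = e^{10} + 1. For every ε with 0 < ε < 1/2 there exists a constant K = K(ε) such that for all positive integers n, Q(n) ≤ K·exp((1+ε)·c·√(log(Cn)/log log(Cn))). -/
open Finset Filter Real

/-- `ell k` is the product of the first `k` primes, `ℓ_k = p_1 ⋯ p_k`. -/
noncomputable def ell (k : ℕ) : ℕ := ∏ i ∈ Finset.range k, Nat.nth Nat.Prime i

/-- `𝒬` is the set of positive integers expressible as `ℓ_1^{b_1} ⋯ ℓ_t^{b_t}`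
for some `t ≥ 1` and non-negative integers `b_1, …, b_t`. -/
def QSet : Set ℕ :=
  {q | ∃ t : ℕ, 1 ≤ t ∧ ∃ b : ℕ → ℕ, q = ∏ k ∈ Finset.range t, ell (k + 1) ^ b k}

/-- `Qfun n = |𝒬 ∩ [n]|`, the number of elements of `𝒬` that are at most `n`. -/
noncomputable def Qfun (n : ℕ) : ℕ := (QSet ∩ Set.Icc 1 n).ncard

/-- Since the `i`-th prime is at least `i + 1`, `ℓ_k ≥ k!`. -/
theorem factorial_le_ell (k : ℕ) : k.factorial ≤ ell k := by
  rw [ell, ← Finset.prod_range_add_one_eq_factorial]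
  exact Finset.prod_le_prod' fun i _ => (Nat.le_succ _).trans (Nat.add_two_le_nth_prime i)

theorem two_pow_le_ell (k : ℕ) : 2 ^ k ≤ ell k := by
  rw [ell, ← Finset.card_range k, ← Finset.prod_const, Finset.card_range]
  exact Finset.prod_le_prod' fun i _ => (Nat.le_add_left 2 i).trans (Nat.add_two_le_nth_prime i)

theorem ell_pos (k : ℕ) : 0 < ell k := (Nat.two_pow_pos k).trans_le (two_pow_le_ell k)

theorem log_two_le_log_ell_succ (k : ℕ) : log 2 ≤ log (ell (k + 1)) := by
  have h : 2 ≤ ell (k + 1) :=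
    (Nat.le_self_pow (Nat.succ_ne_zero k) 2).trans (two_pow_le_ell (k + 1))
  exact log_le_log two_pos (by exact_mod_cast h)

theorem mul_log_sub_one_le_log_ell (k : ℕ) (hk : k ≠ 0) :
    k * (log k - 1) ≤ log (ell k) := by
  have h1 := Stirling.le_log_factorial_stirling hk
  have h2 : log (k.factorial : ℝ) ≤ log (ell k) :=
    log_le_log (by exact_mod_cast k.factorial_pos) (by exact_mod_cast factorial_le_ell k)
  have h3 : 0 ≤ log (k : ℝ) := log_natCast_nonneg k
  have h4 : 0 ≤ log (2 * π) := log_nonneg (by linarith [pi_gt_three])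
  linarith

/-- Every element of `𝒬` up to `n` uses only `ℓ_1, …, ℓ_n`, with exponents at most `n`. -/
theorem exists_exponents_of_mem_QSet {n q : ℕ} (hq : q ∈ QSet) (hq0 : 0 < q) (hqn : q ≤ n) :
    ∃ b ∈ Fintype.piFinset (fun _ : Fin n => Finset.range (n + 1)),
      ∏ i : Fin n, ell (i + 1) ^ b i = q := by
  obtain ⟨t, -, b, rfl⟩ := hq
  have hbound : ∀ k ∈ Finset.range t, (k + 1) * b k < n := by
    intro k hk
    have h1 : ell (k + 1) ^ b k ≤ n := (Nat.le_of_dvd hq0 (Finset.dvd_prod_of_mem _ hk)).trans hqn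
    calc (k + 1) * b k < 2 ^ ((k + 1) * b k) := Nat.lt_two_pow_self
      _ = (2 ^ (k + 1)) ^ b k := pow_mul _ _ _
      _ ≤ ell (k + 1) ^ b k := Nat.pow_le_pow_left (two_pow_le_ell _) _
      _ ≤ n := h1
  refine ⟨fun i => if (i : ℕ) < t then b i else 0, ?_, ?_⟩
  · rw [Fintype.mem_piFinset]
    intro i
    rw [Finset.mem_range]
    split_ifs with h
    · have := hbound i (Finset.mem_range.2 h)
      nlinarith
    · omega
  · rw [Fin.prod_univ_eq_prod_range (fun i => ell (i + 1) ^ (if i < t then b i else 0)) n]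
    have h1 : ∏ i ∈ Finset.range n, ell (i + 1) ^ (if i < t then b i else 0) =
        ∏ i ∈ Finset.range (max n t), ell (i + 1) ^ (if i < t then b i else 0) := by
      refine Finset.prod_subset (Finset.range_mono (le_max_left _ _)) fun i _ hi => ?_
      rw [Finset.mem_range, not_lt] at hi
      split_ifs with h
      · have := hbound i (Finset.mem_range.2 h)
        have h0 : b i = 0 := by
          by_contra h0
          have := Nat.pos_of_ne_zero h0
          nlinarith
        rw [h0, pow_zero]
      · exact pow_zero _
    have h2 : ∏ i ∈ Finset.range t, ell (i + 1) ^ b i =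
        ∏ i ∈ Finset.range (max n t), ell (i + 1) ^ (if i < t then b i else 0) := by
      refine (Finset.prod_congr rfl fun i hi => ?_).trans
        (Finset.prod_subset (Finset.range_mono (le_max_right n t)) fun i _ hi => ?_)
      · rw [if_pos (Finset.mem_range.1 hi)]
      · rw [if_neg (by simpa using hi), pow_zero]
    rw [h1, h2]

theorem Qfun_le_self (n : ℕ) : Qfun n ≤ n := by
  calc Qfun n ≤ (Set.Icc 1 n).ncard :=
        Set.ncard_le_ncard Set.inter_subset_right (Set.finite_Icc 1 n)
    _ = n := by simp [Set.ncard_eq_toFinset_card']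

/-- Rankin's bound: `Q(n) ≤ n^s ∏ (1 - ℓ_k^{-s})⁻¹`. -/
theorem Qfun_le_exp {s : ℝ} (hs : 0 < s) (n : ℕ) :
    (Qfun n : ℝ) ≤ exp (s * log n +
      ∑ k ∈ Finset.range n, -log (1 - exp (-(s * log (ell (k + 1)))))) := by
  classical
  set P := Fintype.piFinset (fun _ : Fin n => Finset.range (n + 1))
  set g : (Fin n → ℕ) → ℕ := fun b => ∏ i : Fin n, ell (i + 1) ^ b i with hg
  have hgpos : ∀ b, 0 < g b := fun b => Finset.prod_pos fun i _ => pow_pos (ell_pos _) _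
  have hcard : Qfun n ≤ (P.filter fun b => g b ≤ n).card := by
    rw [Qfun]
    calc (QSet ∩ Set.Icc 1 n).ncard
        ≤ (((P.filter fun b => g b ≤ n).image g : Finset ℕ) : Set ℕ).ncard := by
          refine Set.ncard_le_ncard ?_ (Finset.finite_toSet _)
          rintro q ⟨hq, hq1, hqn⟩
          obtain ⟨b, hb, hbq⟩ := exists_exponents_of_mem_QSet hq hq1 hqn
          rw [Finset.mem_coe, Finset.mem_image]
          exact ⟨b, Finset.mem_filter.2 ⟨hb, hbq.trans_le hqn⟩, hbq⟩
      _ ≤ _ := by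
          rw [Set.ncard_coe_finset]
          exact Finset.card_image_le
  have hx : ∀ k : ℕ, exp (-(s * log (ell (k + 1)))) < 1 := fun k => by
    rw [exp_lt_one_iff, neg_lt_zero]
    exact mul_pos hs ((log_pos one_lt_two).trans_le (log_two_le_log_ell_succ k))
  have hterm : ∀ b, exp (s * (log n - log (g b))) =
      exp (s * log n) * ∏ i : Fin n, exp (-(s * log (ell (i + 1)))) ^ b i := by
    intro b
    have : log (g b) = ∑ i : Fin n, b i * log (ell (i + 1)) := by
      simp only [hg, Nat.cast_prod, Nat.cast_pow]
      rw [log_prod fun i _ => pow_ne_zero _ (by exact_mod_cast (ell_pos _).ne')]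
      simp only [log_pow]
    simp only [← exp_nat_mul]
    rw [← exp_sum, ← exp_add, this, mul_sub, Finset.mul_sum, sub_eq_add_neg,
      ← Finset.sum_neg_distrib]
    congr 2
    exact Finset.sum_congr rfl fun i _ => by ring
  calc (Qfun n : ℝ) ≤ ((P.filter fun b => g b ≤ n).card : ℝ) := by exact_mod_cast hcard
    _ = ∑ b ∈ P.filter (fun b => g b ≤ n), (1 : ℝ) := by simp
    _ ≤ ∑ b ∈ P.filter (fun b => g b ≤ n), exp (s * (log n - log (g b))) := by
        refine Finset.sum_le_sum fun b hb => one_le_exp (mul_nonneg hs.le (sub_nonneg.2 ?_))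
        exact log_le_log (by exact_mod_cast hgpos b)
          (by exact_mod_cast (Finset.mem_filter.1 hb).2)
    _ ≤ ∑ b ∈ P, exp (s * (log n - log (g b))) :=
        Finset.sum_le_sum_of_subset_of_nonneg (Finset.filter_subset _ _)
          fun _ _ _ => (exp_pos _).le
    _ = exp (s * log n) * ∏ i : Fin n, ∑ j ∈ Finset.range (n + 1),
          exp (-(s * log (ell (i + 1)))) ^ j := by
        rw [Finset.prod_univ_sum, Finset.mul_sum]
        exact Finset.sum_congr rfl fun b _ => hterm b
    _ ≤ exp (s * log n) * ∏ i : Fin n, (1 - exp (-(s * log (ell (i + 1)))))⁻¹ := by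
        refine mul_le_mul_of_nonneg_left (Finset.prod_le_prod
          (fun i _ => Finset.sum_nonneg fun j _ => pow_nonneg (exp_pos _).le _)
          fun i _ => ?_) (exp_pos _).le
        rw [← tsum_geometric_of_lt_one (exp_pos _).le (hx i)]
        exact (summable_geometric_of_lt_one (exp_pos _).le (hx i)).sum_le_tsum _
          fun j _ => pow_nonneg (exp_pos _).le _
    _ = _ := by
        rw [exp_add, exp_sum,
          Fin.prod_univ_eq_prod_range (fun i => (1 - exp (-(s * log (ell (i + 1)))))⁻¹) n]
        congr 1
        refine Finset.prod_congr rfl fun i _ => ?_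
        rw [exp_neg (log _), exp_log (sub_pos.2 (hx i))]

theorem neg_log_one_sub_exp_neg_antitone {x y : ℝ} (hx : 0 < x) (hxy : x ≤ y) :
    -log (1 - exp (-y)) ≤ -log (1 - exp (-x)) := by
  have h1 : exp (-y) ≤ exp (-x) := exp_le_exp.2 (by linarith)
  have h2 : exp (-x) < 1 := exp_lt_one_iff.2 (by linarith)
  exact neg_le_neg (log_le_log (by linarith) (by linarith))

theorem neg_log_one_sub_exp_neg_nonneg {x : ℝ} (hx : 0 < x) : 0 ≤ -log (1 - exp (-x)) := by
  have h2 : exp (-x) < 1 := exp_lt_one_iff.2 (by linarith)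
  exact neg_nonneg.2 (log_nonpos (by linarith) (by linarith [exp_pos (-x)]))

theorem neg_log_one_sub_exp_neg_le {x : ℝ} (hx : 0 < x) :
    -log (1 - exp (-x)) ≤ log (1 + x⁻¹) := by
  have h2 : exp (-x) < 1 := exp_lt_one_iff.2 (by linarith)
  have h3 : exp (-x) ≤ (1 + x)⁻¹ := by
    rw [exp_neg]
    exact inv_anti₀ (by linarith) (by linarith [add_one_le_exp x])
  rw [← log_inv]
  refine log_le_log (inv_pos.2 (by linarith)) ?_
  rw [show 1 + x⁻¹ = (1 - (1 + x)⁻¹)⁻¹ by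
    have : 1 + x - 1 ≠ 0 := by simpa using hx.ne'
    field_simp
    ring]
  refine inv_anti₀ ?_ (by linarith)
  have : (1 + x)⁻¹ < 1 := inv_lt_one_of_one_lt₀ (by linarith)
  linarith

/-- The generating function of partitions satisfies `∑ -log (1 - e^{-hk}) ≤ π² / (6h)`. -/
theorem sum_neg_log_one_sub_exp_neg_le {h : ℝ} (hh : 0 < h) (N : ℕ) :
    ∑ k ∈ Finset.range N, -log (1 - exp (-(h * (k + 1)))) ≤ π ^ 2 / (6 * h) := by
  have hlt : ∀ k : ℕ, exp (-(h * (k + 1))) < 1 := fun k =>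
    exp_lt_one_iff.2 (neg_neg_of_pos (by positivity))
  have h1 : HasSum (fun m : ℕ => ∑ k ∈ Finset.range N,
      exp (-(h * (k + 1))) ^ (m + 1) / ((m : ℝ) + 1))
      (∑ k ∈ Finset.range N, -log (1 - exp (-(h * (k + 1))))) :=
    hasSum_sum fun k _ => hasSum_pow_div_log_of_abs_lt_one
      (by rw [abs_of_pos (exp_pos _)]; exact hlt k)
  have h2 : HasSum (fun m : ℕ => (1 / h) * (1 / ((m + 1 : ℕ) : ℝ) ^ 2)) (1 / h * (π ^ 2 / 6)) := by
    refine HasSum.mul_left _ ?_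
    exact (hasSum_nat_add_iff (f := fun n : ℕ => 1 / (n : ℝ) ^ 2) 1).2
      (by simpa using hasSum_zeta_two)
  refine (hasSum_le (fun m => ?_) h1 h2).trans (le_of_eq (by field_simp))
  set x : ℝ := h * (m + 1) with hx
  have hx0 : 0 < x := by positivity
  have hy1 : exp (-x) < 1 := exp_lt_one_iff.2 (by linarith)
  have hgeom : ∑ k ∈ Finset.range N, exp (-(h * (k + 1))) ^ (m + 1) ≤ 1 / x := by
    calc ∑ k ∈ Finset.range N, exp (-(h * (k + 1))) ^ (m + 1)
        = exp (-x) * ∑ k ∈ Finset.range N, exp (-x) ^ k := by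
          rw [Finset.mul_sum]
          refine Finset.sum_congr rfl fun k _ => ?_
          rw [← exp_nat_mul, ← exp_nat_mul, ← exp_add, hx]
          congr 1
          push_cast
          ring
      _ ≤ exp (-x) * (1 - exp (-x))⁻¹ := by
          refine mul_le_mul_of_nonneg_left ?_ (exp_pos _).le
          rw [← tsum_geometric_of_lt_one (exp_pos _).le hy1]
          exact (summable_geometric_of_lt_one (exp_pos _).le hy1).sum_le_tsum _
            fun j _ => pow_nonneg (exp_pos _).le _
      _ ≤ 1 / x := by
          rw [← div_eq_mul_inv, div_le_div_iff₀ (by linarith) hx0]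
          have h3 : exp (-x) * exp x = 1 := by rw [← exp_add]; simp
          nlinarith [add_one_le_exp x, exp_pos (-x)]
  rw [← Finset.sum_div]
  calc (∑ k ∈ Finset.range N, exp (-(h * (k + 1))) ^ (m + 1)) / ((m : ℝ) + 1)
      ≤ (1 / x) / ((m : ℝ) + 1) := by gcongr
    _ = _ := by
        rw [hx]
        push_cast
        field_simp

/-- Splitting the Euler product at an index `N`: below `N` each factor is bounded crudely, beyond
`N` the factors are compared with those of the partition generating function. -/
theorem sum_neg_log_one_sub_ell_le {s lam : ℝ} (hs : 0 < s) (hlam : 0 < lam) (N n : ℕ) (hN : N ≠ 0)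
    (hNlam : lam ≤ log N - 1) :
    ∑ k ∈ Finset.range n, -log (1 - exp (-(s * log (ell (k + 1))))) ≤
      N * log (1 + (s * log 2)⁻¹) + π ^ 2 / (6 * (s * lam)) := by
  have hl2 : 0 < log 2 := log_pos one_lt_two
  have hc : 0 ≤ log (1 + (s * log 2)⁻¹) := log_nonneg (by
    have : 0 < (s * log 2)⁻¹ := by positivity
    linarith)
  have hstep : ∀ k : ℕ, -log (1 - exp (-(s * log (ell (k + 1))))) ≤
      (if k < N then log (1 + (s * log 2)⁻¹) else 0) +
        -log (1 - exp (-(s * lam * (k + 1)))) := by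
    intro k
    have hpos : 0 < s * lam * (k + 1) := by positivity
    split_ifs with hk
    · have h1 := neg_log_one_sub_exp_neg_antitone (mul_pos hs hl2)
        (mul_le_mul_of_nonneg_left (log_two_le_log_ell_succ k) hs.le)
      have h2 := neg_log_one_sub_exp_neg_le (mul_pos hs hl2)
      linarith [neg_log_one_sub_exp_neg_nonneg hpos]
    · rw [zero_add]
      refine neg_log_one_sub_exp_neg_antitone hpos ?_
      have h1 := mul_log_sub_one_le_log_ell (k + 1) k.succ_ne_zero
      have h2 : log (N : ℝ) ≤ log ((k + 1 : ℕ) : ℝ) :=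
        log_le_log (by exact_mod_cast Nat.pos_of_ne_zero hN) (by exact_mod_cast by omega)
      rw [mul_assoc]
      refine mul_le_mul_of_nonneg_left (le_trans ?_ h1) hs.le
      rw [mul_comm, ← Nat.cast_succ]
      exact mul_le_mul_of_nonneg_left (by linarith) (Nat.cast_nonneg _)
  refine (Finset.sum_le_sum fun k _ => hstep k).trans ?_
  rw [Finset.sum_add_distrib]
  refine add_le_add ?_ (sum_neg_log_one_sub_exp_neg_le (mul_pos hs hlam) n)
  rw [← Finset.sum_filter, Finset.sum_const, nsmul_eq_mul]
  refine mul_le_mul_of_nonneg_right ?_ hc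
  have : (Finset.range n).filter (· < N) ⊆ Finset.range N := fun k hk =>
    Finset.mem_range.2 (Finset.mem_filter.1 hk).2
  exact_mod_cast (Finset.card_le_card this).trans_eq (Finset.card_range N)

/-- The optimised exponent in Rankin's bound, for `M ≥ log n` large. -/
theorem eventually_rankin_exponent_le {ε : ℝ} (hε : 0 < ε) (hε' : ε < 1 / 2) :
    ∀ᶠ M : ℝ in atTop, ∃ s lam : ℝ, ∃ N : ℕ, 0 < s ∧ 0 < lam ∧ N ≠ 0 ∧ lam ≤ log N - 1 ∧
      s * M + (N * log (1 + (s * log 2)⁻¹) + π ^ 2 / (6 * (s * lam))) ≤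
        (1 + ε) * (2 * π / √3) * √(M / log M) := by
  set a : ℝ := 1 / 2 - ε / 8 with ha
  have hlog : ∀ᶠ M : ℝ in atTop, 64 / ε ≤ log M := tendsto_log_atTop.eventually_ge_atTop _
  have hpow : ∀ᶠ M : ℝ in atTop, log M ^ (2 : ℝ) ≤ ε / 4 * M ^ (ε / 8) := by
    filter_upwards [(isLittleO_log_rpow_rpow_atTop 2 (by linarith : 0 < ε / 8)).bound
      (by linarith : 0 < ε / 4), eventually_ge_atTop 1] with M hM hM1
    rwa [norm_of_nonneg (rpow_nonneg (log_nonneg hM1) _),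
      norm_of_nonneg (rpow_nonneg (by linarith) _)] at hM
  filter_upwards [hlog, hpow, eventually_ge_atTop 2] with M hL hP hM2
  set L := log M with hLdef
  have hL1 : 64 < L := lt_of_lt_of_le (by rw [lt_div_iff₀ hε]; linarith) hL
  have hεL : 64 ≤ ε * L := by rw [div_le_iff₀ hε] at hL; linarith
  have hM0 : 0 < M := by linarith
  have hL0 : 0 < L := by linarith
  have h3 : 0 < √3 := by positivity
  have hsqM : 0 < √M := sqrt_pos.2 hM0
  have hsqL : 0 < √L := sqrt_pos.2 hL0
  have hMsq : √M * √M = M := mul_self_sqrt hM0.le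
  have hLsq : √L * √L = L := mul_self_sqrt hL0.le
  have hMa : 1 ≤ M ^ a := one_le_rpow (by linarith) (by linarith)
  have hceil := Nat.ceil_lt_add_one (zero_le_one.trans hMa)
  refine ⟨π / (√3 * √M * √L), L / (2 * (1 + ε)), ⌈M ^ a⌉₊, by positivity, by positivity,
    (Nat.ceil_pos.2 (by linarith)).ne', ?_, ?_⟩
  · have h1 : a * L ≤ log (⌈M ^ a⌉₊ : ℝ) := by
      rw [hLdef, ← log_rpow hM0]
      exact log_le_log (by linarith) (Nat.le_ceil _)
    refine le_trans ?_ (sub_le_sub_right h1 1)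
    rw [div_le_iff₀ (by linarith), ha]
    nlinarith
  · rw [sqrt_div hM0.le]
    have e1 : π / (√3 * √M * √L) * M = π / √3 * (√M / √L) := by
      nth_rewrite 2 [← hMsq]
      field_simp
    have e2 : π ^ 2 / (6 * (π / (√3 * √M * √L) * (L / (2 * (1 + ε))))) =
        (1 + ε) * (π / √3) * (√M / √L) := by
      nth_rewrite 2 [← hLsq]
      field_simp
      rw [sq_sqrt (by norm_num)]
      ring
    have e3 : (⌈M ^ a⌉₊ : ℝ) * log (1 + (π / (√3 * √M * √L) * log 2)⁻¹) ≤
        ε * (π / √3) * (√M / √L) := by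
      have hl2 : 0.6931471803 < log 2 := log_two_gt_d9
      have hinv : (π / (√3 * √M * √L) * log 2)⁻¹ ≤ M := by
        have hLM : √L ≤ √M := sqrt_le_sqrt (by linarith [log_le_sub_one_of_pos hM0])
        have h32 : √3 ≤ 2 := sqrt_le_iff.2 (by norm_num)
        rw [inv_le_comm₀ (by positivity) hM0, div_mul_eq_mul_div, le_div_iff₀ (by positivity),
          inv_mul_le_iff₀ hM0]
        have h4 : √M * √L ≤ M := by nlinarith
        have h5 : 2 ≤ π * log 2 := by nlinarith [pi_gt_three]
        nlinarith [mul_pos hsqM hsqL]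
      have hlogle : log (1 + (π / (√3 * √M * √L) * log 2)⁻¹) ≤ 2 * L := by
        calc log (1 + (π / (√3 * √M * √L) * log 2)⁻¹) ≤ log (M ^ 2) :=
              log_le_log (by positivity) (by nlinarith)
          _ = 2 * L := by rw [log_pow, ← hLdef]; norm_num
      have hπ : 1 ≤ π / √3 := by
        rw [one_le_div h3]
        linarith [pi_gt_three, (sqrt_le_iff.2 (by norm_num) : √3 ≤ 2)]
      have hmain : 4 * M ^ a * L ≤ ε * (√M / √L) := by
        have hsplit : M ^ a * M ^ (ε / 8) = √M := by
          rw [← rpow_add hM0, sqrt_eq_rpow, ha]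
          congr 1
          ring
        rw [← mul_div_assoc, le_div_iff₀ hsqL]
        have h6 : √L ≤ L := by nlinarith
        rw [rpow_two] at hP
        calc 4 * M ^ a * L * √L ≤ 4 * M ^ a * L * L := by gcongr
          _ = 4 * M ^ a * L ^ 2 := by ring
          _ ≤ 4 * M ^ a * (ε / 4 * M ^ (ε / 8)) := by gcongr
          _ = ε * √M := by rw [← hsplit]; ring
      calc (⌈M ^ a⌉₊ : ℝ) * log (1 + (π / (√3 * √M * √L) * log 2)⁻¹)
          ≤ (2 * M ^ a) * (2 * L) := by
            refine mul_le_mul (by linarith) hlogle (log_nonneg ?_) (by linarith)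
            exact le_add_of_nonneg_right (by positivity)
        _ = 4 * M ^ a * L := by ring
        _ ≤ ε * (√M / √L) := hmain
        _ ≤ ε * (π / √3) * (√M / √L) := by
            have : 0 ≤ √M / √L := by positivity
            exact mul_le_mul_of_nonneg_right (by nlinarith) this
    rw [e1, e2]
    calc _ ≤ π / √3 * (√M / √L) + (ε * (π / √3) * (√M / √L) +
          (1 + ε) * (π / √3) * (√M / √L)) := by gcongr
      _ = (1 + ε) * (2 * π / √3) * (√M / √L) := by ring

/-- Upper bound: with `c = 2π/√3` and `C = e^{10} + 1`, for every `0 < ε < 1/2` there is a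
constant `K = K(ε)` such that `Q(n) ≤ K · exp((1+ε)·c·√(log(Cn)/log log(Cn)))` for all `n ≥ 1`. -/
theorem Q_upper_bound (ε : ℝ) (hε : 0 < ε) (hε' : ε < 1 / 2) :
    ∃ K : ℝ, 0 < K ∧ ∀ n : ℕ, 0 < n →
      (Qfun n : ℝ) ≤ K * Real.exp ((1 + ε) * (2 * π / Real.sqrt 3) *
        Real.sqrt (Real.log ((Real.exp 10 + 1) * n) /
          Real.log (Real.log ((Real.exp 10 + 1) * n)))) := by
  obtain ⟨M₀, hM₀⟩ := eventually_atTop.1 (eventually_rankin_exponent_le hε hε')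
  refine ⟨exp M₀ + 1, by positivity, fun n hn => ?_⟩
  set M := log ((exp 10 + 1) * n) with hM
  have hn0 : (0 : ℝ) < n := by exact_mod_cast hn
  have hle : log n ≤ M := log_le_log hn0 (by nlinarith [exp_pos 10])
  have hexp : 1 ≤ exp ((1 + ε) * (2 * π / √3) * √(M / log M)) := one_le_exp (by positivity)
  rcases le_total M₀ M with hbig | hsmall
  · obtain ⟨s, lam, N, hs, hlam, hN, hNlam, hbound⟩ := hM₀ M hbig
    have h1 := sum_neg_log_one_sub_ell_le hs hlam N n hN hNlam
    have h2 := mul_le_mul_of_nonneg_left hle hs.le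
    calc (Qfun n : ℝ) ≤ _ := Qfun_le_exp hs n
      _ ≤ exp ((1 + ε) * (2 * π / √3) * √(M / log M)) := exp_le_exp.2 (by linarith)
      _ ≤ _ := le_mul_of_one_le_left (exp_pos _).le (by linarith [exp_pos M₀])
  · calc (Qfun n : ℝ) ≤ n := by exact_mod_cast Qfun_le_self n
      _ = exp (log n) := (exp_log hn0).symm
      _ ≤ exp M₀ + 1 := by linarith [exp_le_exp.2 (hle.trans hsmall)]
      _ ≤ _ := le_mul_of_one_le_right (by positivity) hexp
end

section
/- Let c = 2π/√3 and C = e^{1000} + 1. For every ε with 0 < ε < 1/2 there exists a constant K = K(ε) such that for all positive integers n, Q(n) ≥ (1/K)·exp((1−ε)·c·√(log(Cn)/log log(Cn))). -/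
open Finset Filter Real

/-- The weighted sum `∑ (k + 1) b_k`, i.e. the number partitioned when `b` records the
multiplicities of the parts `1, …, t`. -/
noncomputable def weight {t : ℕ} (b : Fin t → ℕ) : ℝ := ∑ k : Fin t, ((k : ℝ) + 1) * b k

/-- The vectors of multiplicities in `{0, …, B - 1}` for the parts `1, …, t`. -/
def multBox (t B : ℕ) : Finset (Fin t → ℕ) := Fintype.piFinset fun _ => Finset.range B

lemma sum_multBox_exp (t B : ℕ) (s : ℝ) :
    ∑ b ∈ multBox t B, exp (-s * weight b) =
      ∏ k : Fin t, ∑ j ∈ Finset.range B, exp (-s * ((k : ℝ) + 1)) ^ j := by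
  rw [Finset.prod_univ_sum]
  refine Finset.sum_congr rfl fun b _ => ?_
  rw [weight, Finset.mul_sum, exp_sum]
  refine Finset.prod_congr rfl fun k _ => ?_
  rw [← exp_nat_mul]
  ring_nf

lemma exp_neg_mul_lt_one {s : ℝ} (hs : 0 < s) (k : ℕ) : exp (-s * ((k : ℝ) + 1)) < 1 := by
  rw [exp_lt_one_iff]
  have : 0 < s * ((k : ℝ) + 1) := by positivity
  linarith

lemma exp_neg_sum_log {t : ℕ} {s : ℝ} (hs : 0 < s) :
    exp (∑ k : Fin t, -log (1 - exp (-s * ((k : ℝ) + 1)))) =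
      ∏ k : Fin t, (1 - exp (-s * ((k : ℝ) + 1)))⁻¹ := by
  rw [exp_sum]
  refine Finset.prod_congr rfl fun k _ => ?_
  rw [exp_neg, exp_log (by linarith [exp_neg_mul_lt_one hs k])]

lemma hasSum_sum_neg_log (t : ℕ) {s : ℝ} (hs : 0 < s) :
    HasSum (fun j : ℕ => ∑ k : Fin t, exp (-s * ((k : ℝ) + 1)) ^ (j + 1) / ((j : ℝ) + 1))
      (∑ k : Fin t, -log (1 - exp (-s * ((k : ℝ) + 1)))) := by
  refine hasSum_sum fun k _ => hasSum_pow_div_log_of_abs_lt_one ?_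
  rw [abs_of_pos (exp_pos _)]
  exact exp_neg_mul_lt_one hs k

lemma sum_exp_pow (t j : ℕ) {s : ℝ} (hs : 0 < s) :
    ∑ k : Fin t, exp (-s * ((k : ℝ) + 1)) ^ (j + 1) / ((j : ℝ) + 1) =
      (1 - exp (-(s * (j + 1))) ^ t) / (exp (s * (j + 1)) - 1) / (j + 1) := by
  have hu : 0 < s * ((j : ℝ) + 1) := by positivity
  have h1 : 1 < exp (s * ((j : ℝ) + 1)) := by rwa [one_lt_exp_iff]
  have hy : exp (-(s * ((j : ℝ) + 1))) ≠ 1 := by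
    rw [Ne, exp_eq_one_iff]; linarith
  rw [← Finset.sum_div]
  congr 1
  have : ∀ k : Fin t, exp (-s * ((k : ℝ) + 1)) ^ (j + 1) =
      exp (-(s * (j + 1))) * exp (-(s * (j + 1))) ^ (k : ℕ) := by
    intro k
    rw [← exp_nat_mul, ← exp_nat_mul, ← exp_add]
    push_cast
    ring_nf
  simp_rw [this]
  rw [← Finset.mul_sum, Fin.sum_univ_eq_sum_range
    (fun k => exp (-(s * ((j : ℝ) + 1))) ^ k) t, geom_sum_eq hy]
  generalize exp (-(s * ((j : ℝ) + 1))) ^ t = z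
  rw [exp_neg] at hy ⊢
  generalize exp (s * ((j : ℝ) + 1)) = e at *
  have : e - 1 ≠ 0 := by linarith
  have : 1 - e ≠ 0 := by intro h; linarith
  have : e⁻¹ - 1 ≠ 0 := sub_ne_zero.2 hy
  have : e ≠ 0 := by linarith
  field_simp
  ring

lemma hasSum_one_div_succ_sq :
    HasSum (fun j : ℕ => 1 / ((j : ℝ) + 1) ^ 2) (π ^ 2 / 6) := by
  have h := (hasSum_nat_add_iff' 1).2 hasSum_zeta_two
  simpa using h

lemma sum_neg_log_le (t : ℕ) {s : ℝ} (hs : 0 < s) :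
    ∑ k : Fin t, -log (1 - exp (-s * ((k : ℝ) + 1))) ≤ π ^ 2 / 6 / s := by
  refine hasSum_le (fun j => ?_) (hasSum_sum_neg_log t hs) (hasSum_one_div_succ_sq.div_const s)
  rw [sum_exp_pow t j hs]
  have hu : 0 < s * ((j : ℝ) + 1) := by positivity
  have h1 : s * ((j : ℝ) + 1) ≤ exp (s * ((j : ℝ) + 1)) - 1 := by
    linarith [add_one_le_exp (s * ((j : ℝ) + 1))]
  have h2 : 1 - exp (-(s * ((j : ℝ) + 1))) ^ t ≤ 1 := by
    have : 0 < exp (-(s * ((j : ℝ) + 1))) ^ t := by positivity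
    linarith
  calc _ ≤ 1 / (s * ((j : ℝ) + 1)) / (j + 1) := by gcongr
    _ = _ := by field_simp

lemma sum_multBox_exp_le (t B : ℕ) {s : ℝ} (hs : 0 < s) :
    ∑ b ∈ multBox t B, exp (-s * weight b) ≤ exp (π ^ 2 / 6 / s) := by
  rw [sum_multBox_exp]
  refine le_trans ?_ (exp_le_exp.2 (sum_neg_log_le t hs))
  rw [exp_neg_sum_log hs]
  refine Finset.prod_le_prod (fun k _ => by positivity) fun k _ => ?_
  have h1 := exp_neg_mul_lt_one hs k
  rw [← tsum_geometric_of_lt_one (exp_pos _).le h1]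
  exact (summable_geometric_of_lt_one (exp_pos _).le h1).sum_le_tsum _
    fun j _ => by positivity

lemma exists_lt_sum_neg_log {γ : ℝ} (hγ : 0 < γ) (hγ1 : γ < 1) :
    ∃ A s₀ : ℝ, 0 < A ∧ 0 < s₀ ∧ ∀ s : ℝ, 0 < s → s < s₀ → ∀ t : ℕ, A ≤ s * t →
      (1 - γ) * (π ^ 2 / 6) / s < ∑ k : Fin t, -log (1 - exp (-s * ((k : ℝ) + 1))) := by
  have hκ : 0 < π ^ 2 / 6 := by positivity
  obtain ⟨J, hJ⟩ : ∃ J : ℕ, (1 - γ / 2) * (π ^ 2 / 6) <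
      ∑ j ∈ Finset.range J, 1 / ((j : ℝ) + 1) ^ 2 :=
    (hasSum_one_div_succ_sq.tendsto_sum_nat.eventually
      (lt_mem_nhds (by nlinarith))).exists
  set Z := ∑ j ∈ Finset.range J, 1 / ((j : ℝ) + 1) ^ 2 with hZ
  have hlim : Tendsto (fun s : ℝ => (1 - γ / 2) * exp (-(s * J)) * Z) (nhds 0)
      (nhds ((1 - γ / 2) * exp (-(0 * J)) * Z)) :=
    Continuous.tendsto (by fun_prop) 0
  have hev := hlim.eventually (lt_mem_nhds (a := (1 - γ) * (π ^ 2 / 6)) (by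
    simp only [zero_mul, neg_zero, exp_zero, mul_one]
    nlinarith [mul_pos hγ hγ]))
  obtain ⟨s₀, hs₀, hball⟩ := Metric.eventually_nhds_iff.1 hev
  refine ⟨log (2 / γ), s₀, log_pos (by rw [lt_div_iff₀ hγ]; linarith), hs₀, ?_⟩
  intro s hs hs' t ht
  have hmain := hball (y := s) (by simpa [abs_of_pos hs] using hs')
  have hst : exp (-(s * t)) ≤ γ / 2 := by
    calc exp (-(s * t)) ≤ exp (-log (2 / γ)) := exp_le_exp.2 (by linarith)
      _ = γ / 2 := by rw [exp_neg, exp_log (by positivity), inv_div]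
  calc (1 - γ) * (π ^ 2 / 6) / s < (1 - γ / 2) * exp (-(s * J)) * Z / s := by gcongr
    _ = ∑ j ∈ Finset.range J, (1 - γ / 2) * exp (-(s * J)) * (1 / ((j : ℝ) + 1) ^ 2) / s := by
      rw [hZ, Finset.mul_sum, Finset.sum_div]
    _ ≤ ∑ j ∈ Finset.range J,
          ∑ k : Fin t, exp (-s * ((k : ℝ) + 1)) ^ (j + 1) / ((j : ℝ) + 1) := by
      refine Finset.sum_le_sum fun j hj => ?_
      rw [sum_exp_pow t j hs]
      have hu : 0 < s * ((j : ℝ) + 1) := by positivity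
      have hjJ : (j : ℝ) + 1 ≤ J := by exact_mod_cast Finset.mem_range.1 hj
      have h1 : 0 < exp (s * ((j : ℝ) + 1)) - 1 := by
        linarith [add_one_le_exp (s * ((j : ℝ) + 1))]
      have h2 : exp (s * ((j : ℝ) + 1)) - 1 ≤ s * (j + 1) * exp (s * (j + 1)) := by
        have := add_one_le_exp (-(s * ((j : ℝ) + 1)))
        have h3 : exp (-(s * ((j : ℝ) + 1))) * exp (s * (j + 1)) = 1 := by
          rw [← exp_add]; simp
        nlinarith [exp_pos (s * ((j : ℝ) + 1))]
      have h4 : exp (-(s * ((j : ℝ) + 1))) ^ t ≤ γ / 2 := by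
        refine le_trans ?_ hst
        rw [← exp_nat_mul, exp_le_exp]
        have : 0 ≤ s * t * j := by positivity
        linarith
      have h5 : exp (-(s * J)) ≤ exp (-(s * ((j : ℝ) + 1))) :=
        exp_le_exp.2 (by nlinarith)
      calc _ ≤ (1 - γ / 2) * exp (-(s * ((j : ℝ) + 1))) * (1 / ((j : ℝ) + 1) ^ 2) / s := by
            gcongr; linarith
        _ = (1 - γ / 2) / (s * (j + 1) * exp (s * (j + 1))) / (j + 1) := by
            rw [exp_neg]; field_simp
        _ ≤ _ := by gcongr; linarith
    _ ≤ _ := by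
      refine sum_le_hasSum _ (fun j _ => ?_) (hasSum_sum_neg_log t hs)
      positivity

lemma exists_lt_sum_multBox_exp (t : ℕ) {s x : ℝ} (hs : 0 < s)
    (hx : x < ∑ k : Fin t, -log (1 - exp (-s * ((k : ℝ) + 1)))) :
    ∃ B : ℕ, exp x < ∑ b ∈ multBox t B, exp (-s * weight b) := by
  have hlim : Tendsto (fun B : ℕ => ∑ b ∈ multBox t B, exp (-s * weight b)) atTop
      (nhds (∏ k : Fin t, (1 - exp (-s * ((k : ℝ) + 1)))⁻¹)) := by
    simp_rw [sum_multBox_exp]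
    exact tendsto_finsetProd _ fun k _ =>
      (hasSum_geometric_of_lt_one (exp_pos _).le (exp_neg_mul_lt_one hs k)).tendsto_sum_nat
  rw [← exp_neg_sum_log hs] at hlim
  exact (hlim.eventually (lt_mem_nhds (exp_lt_exp.2 hx))).exists

open Classical in
lemma sum_multBox_exp_le_card_add (t B : ℕ) {s r : ℝ} (M N : ℝ) (hs : 0 ≤ s) (hr : 0 ≤ r) :
    ∑ b ∈ multBox t B, exp (-s * weight b) ≤
      #{b ∈ multBox t B | weight b ≤ N} * exp (-s * M) +
        exp (r * M) * ∑ b ∈ multBox t B, exp (-(s + r) * weight b) +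
        exp (-(r * N)) * ∑ b ∈ multBox t B, exp (-(s - r) * weight b) := by
  rw [Finset.card_filter, Nat.cast_sum, Finset.sum_mul, Finset.mul_sum, Finset.mul_sum,
    ← Finset.sum_add_distrib, ← Finset.sum_add_distrib]
  refine Finset.sum_le_sum fun b _ => ?_
  rw [← exp_add, ← exp_add]
  generalize weight b = w
  have p1 := exp_pos (r * M + -(s + r) * w)
  have p2 := exp_pos (-(r * N) + -(s - r) * w)
  have p3 := exp_pos (-s * M)
  by_cases hN : w ≤ N
  · rw [if_pos hN]
    push_cast
    rcases le_total M w with hM | hM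
    · have : exp (-s * w) ≤ exp (-s * M) := exp_le_exp.2 (by nlinarith)
      linarith
    · have : exp (-s * w) ≤ exp (r * M + -(s + r) * w) := exp_le_exp.2 (by nlinarith)
      linarith
  · rw [if_neg hN]
    have : exp (-s * w) ≤ exp (-(r * N) + -(s - r) * w) := exp_le_exp.2 (by nlinarith)
    push_cast
    linarith

lemma upper_tail_exponent_le {δ : ℝ} (hδ : 0 < δ) (hδ1 : δ < 1) :
    -(δ / 4 * (1 + δ)) + (1 - δ / 4)⁻¹ ≤ 1 - δ ^ 2 / 8 := by
  have h : (1 - δ / 4)⁻¹ ≤ 1 + δ / 4 + δ ^ 2 / 8 := by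
    rw [inv_le_iff_one_le_mul₀ (by linarith)]
    nlinarith [mul_pos (pow_pos hδ 2) (show 0 < 1 - δ by linarith), pow_pos hδ 2]
  nlinarith

lemma lower_tail_exponent_le {δ : ℝ} (hδ : 0 < δ) :
    δ / 4 * (1 - δ) + (1 + δ / 4)⁻¹ ≤ 1 - δ ^ 2 / 8 := by
  have h : (1 + δ / 4)⁻¹ ≤ 1 - δ / 4 + δ ^ 2 / 8 := by
    rw [inv_le_iff_one_le_mul₀ (by linarith)]
    nlinarith [pow_pos hδ 3, pow_pos hδ 2]
  nlinarith

open Classical in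
/-- Lower bound for the number of partitions of integers up to `(1 + δ) (π² / 6) / s²` into
parts of size at most `t`, where `t` is at least a constant multiple of `1 / s`. -/
lemma exists_card_multBox_filter_ge {δ : ℝ} (hδ : 0 < δ) (hδ1 : δ < 1) :
    ∃ A s₀ : ℝ, 0 < A ∧ 0 < s₀ ∧ ∀ s : ℝ, 0 < s → s < s₀ → ∀ t : ℕ, A ≤ s * t →
      ∃ B : ℕ, 1 / 2 * exp ((2 - 2 * δ) * (π ^ 2 / 6) / s) ≤
        #{b ∈ multBox t B | weight b ≤ (1 + δ) * (π ^ 2 / 6) / s ^ 2} := by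
  set κ := π ^ 2 / 6 with hκ
  have hκ0 : 0 < κ := by positivity
  obtain ⟨A, s₀, hA, hs₀, hL⟩ := exists_lt_sum_neg_log (γ := δ ^ 2 / 16)
    (by positivity) (by nlinarith)
  have hlog4 : 0 < log 4 := log_pos (by norm_num)
  refine ⟨A, min s₀ (δ ^ 2 / 16 * κ / log 4), hA, by positivity, ?_⟩
  intro s hs hs' t ht
  have hs1 : s < s₀ := hs'.trans_le (min_le_left _ _)
  have hs2 : log 4 ≤ δ ^ 2 / 16 * κ / s := by
    have := hs'.trans_le (min_le_right _ _)
    rw [lt_div_iff₀ hlog4] at this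
    rw [le_div_iff₀ hs]
    linarith
  obtain ⟨B, hB⟩ := exists_lt_sum_multBox_exp t hs (hL s hs hs1 t ht)
  refine ⟨B, ?_⟩
  set η := δ / 4 with hη
  have hη0 : 0 < η := by positivity
  set X := κ / s with hX
  have hX0 : 0 < X := by positivity
  have hcard := sum_multBox_exp_le_card_add t B (s := s) (r := η * s) ((1 - δ) * κ / s ^ 2)
    ((1 + δ) * κ / s ^ 2) hs.le (by positivity)
  have hplus := sum_multBox_exp_le t B (s := s + η * s) (by positivity)
  have hminus := sum_multBox_exp_le t B (s := s - η * s) (by nlinarith)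
  rw [← hκ] at hplus hminus
  have hmain : exp ((1 - δ ^ 2 / 16) * X) < ∑ b ∈ multBox t B, exp (-s * weight b) := by
    convert hB using 2
    rw [hX]; ring
  have hquarter : exp ((1 - δ ^ 2 / 8) * X) ≤ 1 / 4 * exp ((1 - δ ^ 2 / 16) * X) := by
    have h4 : (1 / 4 : ℝ) = exp (-log 4) := by
      rw [exp_neg, exp_log (by norm_num)]; norm_num
    rw [h4, ← exp_add, exp_le_exp]
    have : δ ^ 2 / 16 * κ / s = δ ^ 2 / 16 * X := by rw [hX]; ring
    linarith
  have e1 : exp (η * s * ((1 - δ) * κ / s ^ 2)) * exp (κ / (s + η * s)) ≤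
      exp ((1 - δ ^ 2 / 8) * X) := by
    rw [← exp_add, exp_le_exp]
    have h1 : κ / (s + η * s) = X * (1 + η)⁻¹ := by rw [hX]; field_simp
    have h2 : η * s * ((1 - δ) * κ / s ^ 2) = η * (1 - δ) * X := by rw [hX]; field_simp
    rw [h1, h2]
    have := mul_le_mul_of_nonneg_right (lower_tail_exponent_le hδ) hX0.le
    rw [← hη] at this
    linarith
  have e2 : exp (-(η * s * ((1 + δ) * κ / s ^ 2))) * exp (κ / (s - η * s)) ≤
      exp ((1 - δ ^ 2 / 8) * X) := by
    rw [← exp_add, exp_le_exp]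
    have hη1 : 0 < 1 - η := by rw [hη]; linarith
    have h1 : κ / (s - η * s) = X * (1 - η)⁻¹ := by
      rw [hX, show s - η * s = s * (1 - η) by ring]; field_simp
    have h2 : η * s * ((1 + δ) * κ / s ^ 2) = η * (1 + δ) * X := by rw [hX]; field_simp
    rw [h1, h2]
    have := mul_le_mul_of_nonneg_right (upper_tail_exponent_le hδ hδ1) hX0.le
    rw [← hη] at this
    linarith
  have f1 := (mul_le_mul_of_nonneg_left hplus
    (exp_pos (η * s * ((1 - δ) * κ / s ^ 2))).le).trans e1
  have f2 := (mul_le_mul_of_nonneg_left hminus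
    (exp_pos (-(η * s * ((1 + δ) * κ / s ^ 2)))).le).trans e2
  have hfin : 1 / 2 * exp ((1 - δ ^ 2 / 16) * X) ≤
      #{b ∈ multBox t B | weight b ≤ (1 + δ) * κ / s ^ 2} * exp (-s * ((1 - δ) * κ / s ^ 2)) := by
    linarith
  have h6 : exp (-s * ((1 - δ) * κ / s ^ 2)) = (exp ((1 - δ) * X))⁻¹ := by
    rw [← exp_neg, hX]
    congr 1
    field_simp
  rw [h6, ← div_eq_mul_inv, le_div_iff₀ (exp_pos _), mul_assoc, ← exp_add] at hfin
  refine le_trans ?_ hfin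
  gcongr
  rw [mul_div_assoc, ← hX]
  nlinarith [mul_pos (mul_pos hδ (show 0 < 1 - δ by linarith)) hX0]

lemma ell_ne_zero (m : ℕ) : ell m ≠ 0 :=
  Finset.prod_ne_zero_iff.2 fun i _ => (Nat.prime_nth_prime i).ne_zero

lemma factorization_ell (m i : ℕ) :
    (ell m).factorization (Nat.nth Nat.Prime i) = if i < m then 1 else 0 := by
  rw [ell, Nat.factorization_prod fun j _ => (Nat.prime_nth_prime j).ne_zero,
    Finsupp.finsetSum_apply]
  have h : ∀ j, (Nat.nth Nat.Prime j).factorization (Nat.nth Nat.Prime i) =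
      if i = j then 1 else 0 := by
    intro j
    rw [(Nat.prime_nth_prime j).factorization, Finsupp.single_apply]
    simp only [(Nat.nth_injective Nat.infinite_setOfPred_prime).eq_iff, eq_comm]
  simp_rw [h]
  simp

lemma factorization_prod_ell_pow (t : ℕ) (b : ℕ → ℕ) (i : ℕ) :
    (∏ k ∈ Finset.range t, ell (k + 1) ^ b k).factorization (Nat.nth Nat.Prime i) =
      ∑ k ∈ Finset.Ico i t, b k := by
  rw [Nat.factorization_prod fun k _ => pow_ne_zero _ (ell_ne_zero _),
    Finsupp.finsetSum_apply]
  simp only [Nat.factorization_pow, Finsupp.smul_apply, factorization_ell, smul_eq_mul,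
    mul_ite, mul_one, mul_zero]
  rw [← Finset.sum_filter]
  refine Finset.sum_congr ?_ fun _ _ => rfl
  ext k
  simp only [Finset.mem_filter, Finset.mem_range, Finset.mem_Ico]
  omega

lemma eq_of_prod_ell_pow_eq {t : ℕ} {b b' : ℕ → ℕ}
    (h : ∏ k ∈ Finset.range t, ell (k + 1) ^ b k = ∏ k ∈ Finset.range t, ell (k + 1) ^ b' k)
    {i : ℕ} (hi : i < t) : b i = b' i := by
  have key := fun j => (factorization_prod_ell_pow t b j).symm.trans
    ((congrArg (fun q => q.factorization (Nat.nth Nat.Prime j)) h).trans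
      (factorization_prod_ell_pow t b' j))
  have h1 := key i
  rw [Finset.sum_eq_sum_Ico_succ_bot hi, Finset.sum_eq_sum_Ico_succ_bot hi, key (i + 1)] at h1
  omega

lemma log_ell_le {k t : ℕ} (hk : k ≤ t) :
    log (ell (k + 1)) ≤ ((k : ℝ) + 1) * log (Nat.nth Nat.Prime t) := by
  rw [ell, Nat.cast_prod, log_prod fun i _ =>
    Nat.cast_ne_zero.2 (Nat.prime_nth_prime i).ne_zero]
  calc _ ≤ ∑ _i ∈ Finset.range (k + 1), log (Nat.nth Nat.Prime t) := by
        refine Finset.sum_le_sum fun i hi => ?_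
        have : Nat.nth Nat.Prime i ≤ Nat.nth Nat.Prime t :=
          Nat.nth_monotone Nat.infinite_setOfPred_prime (by have := Finset.mem_range.1 hi; omega)
        have h0 : 0 < Nat.nth Nat.Prime i := (Nat.prime_nth_prime i).pos
        gcongr
    _ = _ := by simp

/-- A finite family of multiplicity vectors of small weight gives as many elements of `𝒬`. -/
lemma card_le_Qfun {t n : ℕ} (ht : 1 ≤ t) (hn : 0 < n) (S : Finset (Fin t → ℕ))
    (hS : ∀ b ∈ S, weight b * log (Nat.nth Nat.Prime t) ≤ log n) : #S ≤ Qfun n := by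
  let extend (b : Fin t → ℕ) (k : ℕ) : ℕ := if h : k < t then b ⟨k, h⟩ else 0
  let q (b : Fin t → ℕ) : ℕ := ∏ k ∈ Finset.range t, ell (k + 1) ^ extend b k
  have hq0 : ∀ b, q b ≠ 0 := fun b =>
    Finset.prod_ne_zero_iff.2 fun k _ => pow_ne_zero _ (ell_ne_zero _)
  have hinj : Function.Injective q := by
    intro b b' h
    ext ⟨k, hk⟩
    simpa [extend, hk] using eq_of_prod_ell_pow_eq h hk
  have hle : ∀ b ∈ S, q b ≤ n := by
    intro b hb
    have hlog : log (q b) ≤ log n := by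
      refine le_trans ?_ (hS b hb)
      rw [Nat.cast_prod, log_prod fun k _ =>
        Nat.cast_ne_zero.2 (pow_ne_zero _ (ell_ne_zero _)), Finset.sum_range, weight,
        Finset.sum_mul]
      refine Finset.sum_le_sum fun k _ => ?_
      have := log_ell_le k.isLt.le
      have hk : extend b k = b k := by simp [extend]
      rw [hk, Nat.cast_pow, log_pow]
      nlinarith [Nat.cast_nonneg (α := ℝ) (b k)]
    exact_mod_cast (log_le_log_iff (by exact_mod_cast Nat.pos_of_ne_zero (hq0 b))
      (by exact_mod_cast hn)).1 hlog
  rw [Qfun, ← Finset.card_image_of_injective S hinj, ← Set.ncard_coe_finset]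
  refine Set.ncard_le_ncard ?_ ((Set.finite_Icc 1 n).subset Set.inter_subset_right)
  intro x hx
  obtain ⟨b, hb, rfl⟩ := Finset.mem_image.1 (Finset.mem_coe.1 hx)
  exact ⟨⟨t, ht, extend b, rfl⟩, Nat.pos_of_ne_zero (hq0 b), hle b hb⟩

lemma one_le_Qfun {n : ℕ} (hn : 0 < n) : 1 ≤ Qfun n := by
  have := card_le_Qfun (t := 1) le_rfl hn {0} (by
    simpa [weight] using log_natCast_nonneg n)
  simpa using this

lemma nth_prime_mul_log_two_le (t : ℕ) :
    Nat.nth Nat.Prime t * log 2 ≤ ((t : ℝ) + 3) * log (Nat.nth Nat.Prime t) := by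
  set p := Nat.nth Nat.Prime t with hp
  have hp2 : 2 ≤ p := (Nat.prime_nth_prime t).two_le
  have h1 := Chebyshev.psi_ge p
  have h2 := Chebyshev.psi_le_primeCounting_mul_log p
  have h3 : Nat.primeCounting p = t + 1 := by
    rw [Nat.primeCounting_eq_primeCounting'_succ, Nat.primeCounting', Nat.count_succ, hp,
      if_pos (Nat.prime_nth_prime t)]
    exact congrArg (· + 1) (Nat.primeCounting'_nth_eq t)
  rw [h3] at h2
  have h4 : log ((p : ℝ) + 1) ≤ 2 * log p := by
    have hp2' : (2 : ℝ) ≤ p := by exact_mod_cast hp2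
    rw [show 2 * log (p : ℝ) = log ((p : ℝ) ^ 2) by rw [log_pow]; norm_num]
    exact log_le_log (by positivity) (by nlinarith)
  push_cast at h2
  linarith

lemma eventually_log_nth_prime_le {δ : ℝ} (hδ : 0 < δ) :
    ∀ᶠ t : ℕ in atTop, log (Nat.nth Nat.Prime t) ≤ (1 + δ) * log t := by
  have hexp : 0 < 1 - (1 + δ)⁻¹ := by
    have : (1 + δ)⁻¹ < 1 := inv_lt_one_of_one_lt₀ (by linarith)
    linarith
  have hlog2 : 0 < log 2 := log_pos (by norm_num)
  have hp : Tendsto (fun t : ℕ => (Nat.nth Nat.Prime t : ℝ)) atTop atTop :=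
    tendsto_natCast_atTop_atTop.comp
      (Nat.nth_strictMono Nat.infinite_setOfPred_prime).tendsto_atTop
  have hsmall := hp.eventually
    ((isLittleO_log_rpow_atTop hexp).bound (show 0 < log 2 / 2 by positivity))
  filter_upwards [hsmall, eventually_ge_atTop 3] with t ht ht3
  have h1 := nth_prime_mul_log_two_le t
  have hp1 : (1 : ℝ) < Nat.nth Nat.Prime t := by
    exact_mod_cast (Nat.prime_nth_prime t).one_lt
  set p : ℝ := ((Nat.nth Nat.Prime t : ℕ) : ℝ)
  have hp0 : 0 < p := by linarith
  have hlogp : 0 < log p := log_pos hp1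
  have ht3' : (3 : ℝ) ≤ t := by exact_mod_cast ht3
  rw [norm_of_nonneg hlogp.le, norm_of_nonneg (rpow_nonneg hp0.le _)] at ht
  have hsplit : p ^ (1 + δ)⁻¹ * p ^ (1 - (1 + δ)⁻¹) = p := by
    rw [← rpow_add hp0]; simp
  have hle : p ^ (1 + δ)⁻¹ ≤ t := by
    have ha := rpow_pos_of_pos hp0 (1 + δ)⁻¹
    have hb := rpow_pos_of_pos hp0 (1 - (1 + δ)⁻¹)
    generalize p ^ (1 + δ)⁻¹ = a at *
    generalize p ^ (1 - (1 + δ)⁻¹) = c at *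
    have h2 : a * c * log 2 ≤ (t + 3) * (log 2 / 2 * c) := by
      rw [hsplit]; exact h1.trans (by gcongr)
    have h3 : (c * log 2) * a ≤ (c * log 2) * ((t + 3) / 2) := by linarith
    have := le_of_mul_le_mul_left h3 (by positivity)
    linarith
  have := log_le_log (rpow_pos_of_pos hp0 _) hle
  rw [log_rpow hp0, inv_mul_le_iff₀ (by positivity)] at this
  exact this

lemma tendsto_sqrt_div_log_atTop : Tendsto (fun y : ℝ => √(y / log y)) atTop atTop := by
  refine tendsto_sqrt_atTop.comp ?_
  have h := (isLittleO_log_id_atTop.tendsto_div_nhds_zero)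
  have h' : Tendsto (fun y : ℝ => log y / y) atTop (nhdsWithin 0 (Set.Ioi 0)) := by
    refine tendsto_nhdsWithin_iff.2 ⟨h, ?_⟩
    filter_upwards [eventually_gt_atTop 1] with y hy
    exact div_pos (log_pos hy) (by linarith)
  simpa [Function.comp_def] using tendsto_inv_nhdsGT_zero.comp h'

lemma eventually_exp_le_Qfun {δ : ℝ} (hδ : 0 < δ) (hδ1 : δ < 1) :
    ∀ᶠ y : ℝ in atTop, ∀ n : ℕ, 0 < n → y ≤ (1 + δ) * log n →
      1 / 2 * exp ((1 - δ) / (1 + δ) ^ 2 * (2 * π / √3) * √(y / log y)) ≤ Qfun n := by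
  classical
  obtain ⟨A, s₀, hA, hs₀, hcard⟩ := exists_card_multBox_filter_ge hδ hδ1
  obtain ⟨t₀, ht₀⟩ := eventually_atTop.1 (eventually_log_nth_prime_le hδ)
  set κ := π ^ 2 / 6 with hκ
  have hκ1 : 1 ≤ κ := by nlinarith [pi_gt_three]
  -- `x y` is the reciprocal of the parameter `s` of the partition estimate.
  let x (y : ℝ) : ℝ := π / √3 / (1 + δ) ^ 2 / κ * √(y / log y)
  have hx : Tendsto x atTop atTop :=
    tendsto_sqrt_div_log_atTop.const_mul_atTop (by positivity)
  filter_upwards [eventually_ge_atTop (exp 2), hx.eventually_gt_atTop s₀⁻¹,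
    hx.eventually_ge_atTop 1, hx.eventually_ge_atTop (t₀ / A),
    hx.eventually_ge_atTop (exp (log (A + 1) / δ))] with y hy hxs hx1 hxt hxA n hn hyn
  have hy0 : 0 < y := (exp_pos 2).trans_le hy
  have hlogy : 2 ≤ log y := (le_log_iff_exp_le hy0).2 hy
  have hxsq : κ * x y ^ 2 = 2 * (y / log y) / (1 + δ) ^ 4 := by
    simp only [x, mul_pow, div_pow]
    rw [sq_sqrt (div_nonneg hy0.le (by linarith)), sq_sqrt (by norm_num), hκ]
    field_simp
    norm_num
  have hxe : (2 - 2 * δ) * κ * x y = (1 - δ) / (1 + δ) ^ 2 * (2 * π / √3) * √(y / log y) := by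
    simp only [x]
    field_simp
  generalize x y = X at *
  have hX0 : 0 < X := by linarith
  set t := ⌈A * X⌉₊ with ht
  have htA : A * X ≤ t := Nat.le_ceil _
  have htt₀ : t₀ ≤ t := by
    rw [div_le_iff₀ hA] at hxt
    exact_mod_cast hxt.trans ((mul_comm X A).le.trans htA)
  have ht1 : 1 ≤ t := Nat.ceil_pos.2 (by positivity)
  have hlogt : log t ≤ (1 + δ) * log X := by
    have h1 : (t : ℝ) ≤ (A + 1) * X := by
      have := Nat.ceil_lt_add_one (show 0 ≤ A * X by positivity)
      linarith
    have h2 : log t ≤ log (A + 1) + log X := by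
      rw [← log_mul (by positivity) (by positivity)]
      exact log_le_log (by exact_mod_cast ht1) h1
    have h3 := (le_log_iff_exp_le hX0).2 hxA
    rw [div_le_iff₀ hδ] at h3
    linarith
  have hlogX : log X ≤ log y / 2 := by
    have h1 : X ^ 2 ≤ y := by
      calc X ^ 2 ≤ κ * X ^ 2 := by nlinarith [sq_nonneg X]
        _ = 2 * (y / log y) / (1 + δ) ^ 4 := hxsq
        _ ≤ 2 * (y / log y) / 1 := by
          gcongr
          exact one_le_pow₀ (by linarith)
        _ ≤ y := by
          rw [div_one, ← mul_div_assoc, div_le_iff₀ (by linarith)]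
          nlinarith
    have h2 := log_le_log (by positivity) h1
    rw [log_pow] at h2
    push_cast at h2
    linarith
  have hlogp : log (Nat.nth Nat.Prime t) ≤ (1 + δ) ^ 2 * (log y / 2) :=
    calc _ ≤ (1 + δ) * log t := ht₀ t htt₀
      _ ≤ (1 + δ) * ((1 + δ) * (log y / 2)) := by gcongr; exact hlogt.trans (by gcongr)
      _ = _ := by ring
  obtain ⟨B, hB⟩ := hcard X⁻¹ (by positivity) (inv_lt_of_inv_lt₀ hs₀ hxs) t
    (by rw [inv_mul_eq_div, le_div_iff₀ hX0]; exact htA)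
  rw [div_inv_eq_mul, hxe] at hB
  refine hB.trans ?_
  refine Nat.cast_le.2 (card_le_Qfun ht1 hn _ fun b hb => ?_)
  have hw := (Finset.mem_filter.1 hb).2
  rw [inv_pow, div_inv_eq_mul, mul_assoc, hxsq] at hw
  have hp0 : 0 ≤ log (Nat.nth Nat.Prime t : ℝ) := log_natCast_nonneg _
  calc weight b * log (Nat.nth Nat.Prime t)
      ≤ (1 + δ) * (2 * (y / log y) / (1 + δ) ^ 4) * ((1 + δ) ^ 2 * (log y / 2)) := by gcongr
    _ = y / (1 + δ) := by field_simp
    _ ≤ log n := by rwa [div_le_iff₀ (by positivity), mul_comm]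

/-- Lower bound: with `c = 2π/√3` and `C = e^{1000} + 1`, for every `0 < ε < 1/2` there is a
constant `K = K(ε)` such that `Q(n) ≥ (1/K) · exp((1-ε)·c·√(log(Cn)/log log(Cn)))` for `n ≥ 1`. -/
theorem Q_lower_bound (ε : ℝ) (hε : 0 < ε) (hε' : ε < 1 / 2) :
    ∃ K : ℝ, 0 < K ∧ ∀ n : ℕ, 0 < n →
      (Qfun n : ℝ) ≥ (1 / K) * Real.exp ((1 - ε) * (2 * π / Real.sqrt 3) *
        Real.sqrt (Real.log ((Real.exp 1000 + 1) * n) /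
          Real.log (Real.log ((Real.exp 1000 + 1) * n)))) := by
  set δ := ε / 4 with hδdef
  have hδ : 0 < δ := by positivity
  have hδ1 : δ < 1 := by linarith
  set C := Real.exp 1000 + 1 with hC
  have hC0 : 0 < C := by positivity
  let E (n : ℕ) : ℝ := Real.exp ((1 - ε) * (2 * π / Real.sqrt 3) *
    Real.sqrt (Real.log (C * n) / Real.log (Real.log (C * n))))
  have hlogn : Tendsto (fun n : ℕ => log (n : ℝ)) atTop atTop :=
    tendsto_log_atTop.comp tendsto_natCast_atTop_atTop
  have hy : Tendsto (fun n : ℕ => log (C * n)) atTop atTop :=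
    tendsto_log_atTop.comp (tendsto_natCast_atTop_atTop.const_mul_atTop hC0)
  have hev : ∀ᶠ n : ℕ in atTop, 1 / 2 * E n ≤ Qfun n := by
    filter_upwards [hy.eventually (eventually_exp_le_Qfun hδ hδ1), eventually_gt_atTop 0,
      hlogn.eventually_ge_atTop (log C / δ)] with n hn hn0 hnC
    have hyn : log (C * n) ≤ (1 + δ) * log n := by
      rw [div_le_iff₀ hδ] at hnC
      rw [log_mul hC0.ne' (by positivity)]
      linarith
    refine le_trans ?_ (hn n hn0 hyn)
    have hε4 : 1 - ε ≤ (1 - δ) / (1 + δ) ^ 2 := by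
      rw [le_div_iff₀ (by positivity), show ε = 4 * δ by rw [hδdef]; ring]
      nlinarith [pow_pos hδ 2, pow_pos hδ 3]
    simp only [E]
    gcongr
  obtain ⟨n₀, hn₀⟩ := eventually_atTop.1 hev
  have hE0 : ∀ n, 0 < E n := fun n => exp_pos _
  have hsum : 0 ≤ ∑ m ∈ Finset.range n₀, E m := Finset.sum_nonneg fun m _ => (hE0 m).le
  refine ⟨2 + ∑ m ∈ Finset.range n₀, E m, by positivity, fun n hn => ?_⟩
  change 1 / (2 + ∑ m ∈ Finset.range n₀, E m) * E n ≤ Qfun n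
  rcases le_or_gt n₀ n with h | h
  · refine le_trans ?_ (hn₀ n h)
    have := (hE0 n).le
    gcongr
    linarith
  · have h1 : E n ≤ ∑ m ∈ Finset.range n₀, E m :=
      Finset.single_le_sum (fun m _ => (hE0 m).le) (Finset.mem_range.2 h)
    have h2 : (1 : ℝ) ≤ Qfun n := by exact_mod_cast one_le_Qfun hn
    refine le_trans ?_ h2
    rw [one_div, inv_mul_le_iff₀ (by positivity)]
    linarith
end
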